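/- Let X and Y be real normed spaces, let n ≥ 1, let f = (f_1,…,f_n) ∈ X^n and g = (g_1,…,g_n) ∈ Y^n, and let 0 < c₁ ≤ c₂. Let A be a positive semidefinite real n×n matrix with c₁·|A e| ≤ ‖∑_{i=1}^n e_i • f_i‖_X ≤ c₂·|A e| for all e ∈ ℝ^n, and let B be a positive semidefinite real n×n matrix with c₁·|B e| ≤ ‖∑_{i=1}^n e_i • g_i‖_Y ≤ c₂·|B e| for all e ∈ ℝ^n. Then there is a constant C depending only on n, c₁, c₂ such that ‖A·B‖_op ≤ C · sup{ ∑_{i=1}^n φ(f_i)·ψ(g_i) : φ a continuous linear functional on X with ‖φ‖ ≤ 1, ψ a continuous linear functional on Y with ‖ψ‖ ≤ 1 }. -/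

import Mathlib

open MeasureTheory

universe u v

/-- The Euclidean norm on `Fin k → ℝ`. -/
noncomputable def euclNorm {k : ℕ} (x : Fin k → ℝ) : ℝ := Real.sqrt (∑ i, x i ^ 2)

/-- The operator norm of an `n × n` real matrix with respect to the Euclidean norm. -/
noncomputable def opNorm {n : ℕ} (M : Matrix (Fin n) (Fin n) ℝ) : ℝ :=
  ‖Matrix.toEuclideanCLM (𝕜 := ℝ) M‖

/-- `A` is a reducing matrix for the tuple `f` with respect to `N` (with constants
`c₁ ≤ c₂`): `A` is positive semidefinite and `c₁|Ae| ≤ N(∑ eᵢ • fᵢ) ≤ c₂|Ae|`. -/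
def IsReducing {X : Type*} [AddCommGroup X] [Module ℝ X] (N : X → ℝ)
    {n : ℕ} (f : Fin n → X) (c₁ c₂ : ℝ) (A : Matrix (Fin n) (Fin n) ℝ) : Prop :=
  A.PosSemidef ∧ ∀ e : Fin n → ℝ,
    c₁ * euclNorm (A.mulVec e) ≤ N (∑ i, e i • f i) ∧
      N (∑ i, e i • f i) ≤ c₂ * euclNorm (A.mulVec e)

lemma aux_hb {X : Type*} [NormedAddCommGroup X] [NormedSpace ℝ X] {n : ℕ} (f : Fin n → X)
    (w : Fin n → ℝ) (h : ∀ e : Fin n → ℝ, |e ⬝ᵥ w| ≤ ‖∑ i, e i • f i‖) :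
    ∃ φ : X →L[ℝ] ℝ, ‖φ‖ ≤ 1 ∧ ∀ i, φ (f i) = w i := by
  let T : (Fin n → ℝ) →ₗ[ℝ] X := Fintype.linearCombination ℝ f
  have hT : ∀ e, T e = ∑ i, e i • f i := fun e => Fintype.linearCombination_apply ℝ f e
  let l : (Fin n → ℝ) →ₗ[ℝ] ℝ :=
    { toFun := fun e => e ⬝ᵥ w
      map_add' := fun a b => add_dotProduct a b w
      map_smul' := fun c a => smul_dotProduct c a w }
  have hl : ∀ e, |l e| ≤ ‖T e‖ := fun e => by rw [hT]; exact h e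
  obtain ⟨s, hs⟩ := T.rangeRestrict.exists_rightInverse_of_surjective T.range_rangeRestrict
  have hs' : ∀ y, T (s y) = (y : X) := fun y =>
    congrArg Subtype.val (LinearMap.congr_fun hs y)
  let p : LinearMap.range T →L[ℝ] ℝ := (l ∘ₗ s).mkContinuous 1 (fun y => by
    have := hl (s y)
    rw [hs'] at this
    simpa using this)
  have hp : ‖p‖ ≤ 1 := LinearMap.mkContinuous_norm_le _ zero_le_one _
  obtain ⟨φ, h1, h2⟩ := exists_extension_norm_eq _ p
  refine ⟨φ, h2 ▸ hp, fun i => ?_⟩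
  have hfi : T (Pi.single i 1) = f i := by simp [T]
  have h3 := h1 ⟨T (Pi.single i 1), LinearMap.mem_range_self _ _⟩
  have h4 := hl (s ⟨T (Pi.single i 1), LinearMap.mem_range_self _ _⟩ - Pi.single i 1)
  rw [map_sub T, hs', sub_self, norm_zero, map_sub, abs_nonpos_iff, sub_eq_zero] at h4
  have h5 : l (Pi.single i 1) = w i := by simp [l]
  rw [← h5, ← h4, ← hfi]
  exact h3

lemma euclNorm_eq {n : ℕ} (x : Fin n → ℝ) : euclNorm x = ‖WithLp.toLp 2 x‖ := by
  simp [euclNorm, EuclideanSpace.norm_eq]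

lemma aux_red {X : Type*} [NormedAddCommGroup X] [NormedSpace ℝ X] {n : ℕ} (f : Fin n → X)
    (c₁ c₂ : ℝ) (hc₁ : 0 < c₁) (A : Matrix (Fin n) (Fin n) ℝ)
    (hA : IsReducing (fun x => ‖x‖) f c₁ c₂ A) (v : EuclideanSpace ℝ (Fin n)) (hv : ‖v‖ ≤ 1) :
    ∃ φ : X →L[ℝ] ℝ, ‖φ‖ ≤ 1 ∧ ∀ i, φ (f i) = c₁ * (A.mulVec v.ofLp) i := by
  have hAt : A.transpose = A := by simpa using hA.1.1.eq
  refine aux_hb f (fun i => c₁ * (A.mulVec v.ofLp) i) (fun e => ?_)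
  refine le_trans ?_ (hA.2 e).1
  have h1 : e ⬝ᵥ (fun i => c₁ * (A.mulVec v.ofLp) i)
      = c₁ * inner ℝ v (WithLp.toLp 2 (A.mulVec e)) := by
    have : (fun i => c₁ * (A.mulVec v.ofLp) i) = c₁ • A.mulVec v.ofLp := rfl
    rw [this, dotProduct_smul, Matrix.dotProduct_mulVec, ← Matrix.mulVec_transpose, hAt]
    simp [EuclideanSpace.inner_eq_star_dotProduct]
  rw [h1, abs_mul, abs_of_pos hc₁, euclNorm_eq]
  gcongr
  refine (abs_real_inner_le_norm _ _).trans ?_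
  exact mul_le_of_le_one_left (norm_nonneg _) hv

/-- **Reducing matrices are dominated by the injective tensor norm** (part of
Proposition 3.2): in normed spaces, `‖A·B‖_op ≲ sup { ∑ φ(fᵢ)ψ(gᵢ) : ‖φ‖,‖ψ‖ ≤ 1 }`,
with a constant depending only on `n, c₁, c₂`. -/
theorem stmt8 (n : ℕ) (hn : 1 ≤ n) (c₁ c₂ : ℝ) (hc₁ : 0 < c₁) (hc₁₂ : c₁ ≤ c₂) :
    ∃ C : ℝ, 0 < C ∧
      ∀ (X : Type u) (Y : Type v) [NormedAddCommGroup X] [NormedSpace ℝ X]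
        [NormedAddCommGroup Y] [NormedSpace ℝ Y]
        (f : Fin n → X) (g : Fin n → Y) (A B : Matrix (Fin n) (Fin n) ℝ),
        IsReducing (fun x => ‖x‖) f c₁ c₂ A →
        IsReducing (fun y => ‖y‖) g c₁ c₂ B →
        opNorm (A * B) ≤ C * sSup {t : ℝ | ∃ (φ : X →L[ℝ] ℝ) (ψ : Y →L[ℝ] ℝ),
          ‖φ‖ ≤ 1 ∧ ‖ψ‖ ≤ 1 ∧ t = ∑ i, φ (f i) * ψ (g i)} := by
  refine ⟨(c₁ ^ 2)⁻¹, by positivity, ?_⟩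
  intro X Y _ _ _ _ f g A B hA hB
  set S := {t : ℝ | ∃ (φ : X →L[ℝ] ℝ) (ψ : Y →L[ℝ] ℝ),
          ‖φ‖ ≤ 1 ∧ ‖ψ‖ ≤ 1 ∧ t = ∑ i, φ (f i) * ψ (g i)} with hS
  have hbdd : BddAbove S := by
    refine ⟨∑ i, ‖f i‖ * ‖g i‖, ?_⟩
    rintro t ⟨φ, ψ, h1, h2, rfl⟩
    refine Finset.sum_le_sum fun i _ => ?_
    refine (le_abs_self _).trans ?_
    rw [abs_mul]
    exact mul_le_mul (φ.le_of_opNorm_le h1 (f i) |>.trans (one_mul _).le)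
      (ψ.le_of_opNorm_le h2 (g i) |>.trans (one_mul _).le) (abs_nonneg _) (norm_nonneg _)
  have h0 : 0 ≤ sSup S := le_csSup hbdd ⟨0, 0, by simp, by simp, by simp⟩
  have hAt : A.transpose = A := by simpa using hA.1.1.eq
  have key : ∀ v u : EuclideanSpace ℝ (Fin n), ‖v‖ ≤ 1 → ‖u‖ ≤ 1 →
      c₁ ^ 2 * inner ℝ v (Matrix.toEuclideanCLM (𝕜 := ℝ) (A * B) u) ≤ sSup S := by
    intro v u hv hu
    obtain ⟨φ, hφ, hφ'⟩ := aux_red f c₁ c₂ hc₁ A hA v hv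
    obtain ⟨ψ, hψ, hψ'⟩ := aux_red g c₁ c₂ hc₁ B hB u hu
    refine le_csSup hbdd ⟨φ, ψ, hφ, hψ, ?_⟩
    have h1 : ∑ i, φ (f i) * ψ (g i) = c₁ ^ 2 * (A.mulVec v.ofLp ⬝ᵥ B.mulVec u.ofLp) := by
      simp only [hφ', hψ', dotProduct, Finset.mul_sum]
      exact Finset.sum_congr rfl fun i _ => by ring
    have h2 : inner ℝ v (Matrix.toEuclideanCLM (𝕜 := ℝ) (A * B) u)
        = (A * B).mulVec u.ofLp ⬝ᵥ v.ofLp := by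
      simp [EuclideanSpace.inner_eq_star_dotProduct, Matrix.ofLp_toEuclideanCLM]
    rw [h1, h2, ← Matrix.mulVec_mulVec, dotProduct_comm _ v.ofLp,
      Matrix.dotProduct_mulVec v.ofLp A, ← Matrix.mulVec_transpose, hAt]
  unfold opNorm
  refine ContinuousLinearMap.opNorm_le_of_unit_norm (by positivity) fun u hu => ?_
  set y := Matrix.toEuclideanCLM (𝕜 := ℝ) (A * B) u with hy
  rw [inv_mul_eq_div, le_div_iff₀ (by positivity), mul_comm]
  by_cases hy0 : ‖y‖ = 0
  · simpa [hy0] using h0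
  have h3 := key (‖y‖⁻¹ • y) u (by rw [norm_smul, norm_inv, norm_norm, inv_mul_cancel₀ hy0]) hu.le
  rw [← hy, real_inner_smul_left, real_inner_self_eq_norm_sq] at h3
  have h4 : ‖y‖⁻¹ * ‖y‖ ^ 2 = ‖y‖ := by field_simp
  rwa [h4] at h3
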